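/- Let I ⊆ [n] with |I| ≥ 2 be such that I₁ := {i ∈ I : p_i < β(I)} is nonempty, and set I₂ := I∖I₁. Then the inequality ∑_{i∈I₁} x_i + 2∑_{i∈I₂} x_i ≥ 2 is a valid inequality for K and its pitch is exactly 2. -/

import Mathlib

open Finset

/-- The MinKnap feasible set `K = {x ∈ {0,1}^n : ∑ i, p i * x i ≥ 1}`. -/
def MinKnapK (n : ℕ) (p : Fin n → ℝ) : Set (Fin n → ℝ) :=
  {x | (∀ i, x i = 0 ∨ x i = 1) ∧ 1 ≤ ∑ i, p i * x i}

/-- The pitch of the inequality `∑ i ∈ T, w i * x i ≥ β`: the least `k` such that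
every `k`-element subset `S ⊆ T` satisfies `∑ i ∈ S, w i ≥ β`. -/
noncomputable def pitch {ι : Type*} (T : Finset ι) (w : ι → ℝ) (β : ℝ) : ℕ :=
  sInf {k : ℕ | ∀ S ⊆ T, S.card = k → β ≤ ∑ i ∈ S, w i}

theorem stmt_0 (n : ℕ) (p : Fin n → ℝ) (hp : ∀ i, 0 ≤ p i ∧ p i ≤ 1)
    (I : Finset (Fin n)) (hcard : 2 ≤ I.card)
    (βI : ℝ) (hβI : βI = 1 - ∑ i ∈ Iᶜ, p i)
    (I₁ I₂ : Finset (Fin n))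
    (hI₁ : I₁ = I.filter fun i => p i < βI)
    (hI₁ne : I₁.Nonempty)
    (hI₂ : I₂ = I \ I₁)
    (w : Fin n → ℝ)
    (hw : ∀ i, w i = if i ∈ I₂ then 2 else if i ∈ I₁ then 1 else 0) :
    (∀ x ∈ MinKnapK n p, 2 ≤ ∑ i ∈ I₁, x i + 2 * ∑ i ∈ I₂, x i) ∧
    pitch I w 2 = 2 := by
  have mem1 : ∀ i, i ∈ I₁ ↔ i ∈ I ∧ p i < βI := by intro i; rw [hI₁]; simp
  have hsub : I₁ ⊆ I := fun i hi => ((mem1 i).1 hi).1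
  obtain ⟨a, ha⟩ := hI₁ne
  have haI := (mem1 a).1 ha
  have hβ : 0 < βI := lt_of_le_of_lt (hp a).1 haI.2
  constructor
  · rintro x ⟨hx, hK⟩
    have x0 : ∀ i, 0 ≤ x i := fun i => by rcases hx i with h | h <;> rw [h] <;> norm_num
    have x1 : ∀ i, x i ≤ 1 := fun i => by rcases hx i with h | h <;> rw [h] <;> norm_num
    by_contra hlt
    push Not at hlt
    have s1 : 0 ≤ ∑ i ∈ I₁, x i := sum_nonneg fun i _ => x0 i
    have s2 : 0 ≤ ∑ i ∈ I₂, x i := sum_nonneg fun i _ => x0 i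
    have z2 : ∀ i ∈ I₂, x i = 0 := by
      intro i hi
      rcases hx i with h | h
      · exact h
      · have := single_le_sum (f := x) (fun i _ => x0 i) hi
        linarith
    have e1 : ∑ i ∈ I, p i * x i + ∑ i ∈ Iᶜ, p i * x i = ∑ i, p i * x i :=
      sum_add_sum_compl I _
    have e2 : ∑ i ∈ I₂, p i * x i + ∑ i ∈ I₁, p i * x i = ∑ i ∈ I, p i * x i := by
      rw [hI₂]; exact sum_sdiff hsub
    have e3 : ∑ i ∈ I₂, p i * x i = 0 := sum_eq_zero fun i hi => by rw [z2 i hi, mul_zero]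
    have e4 : ∑ i ∈ Iᶜ, p i * x i ≤ ∑ i ∈ Iᶜ, p i :=
      sum_le_sum fun i _ => mul_le_of_le_one_right (hp i).1 (x1 i)
    have key : ∑ i ∈ I₁, p i * x i < βI := by
      by_cases hz : ∀ i ∈ I₁, x i = 0
      · rw [sum_eq_zero fun i hi => by rw [hz i hi, mul_zero]]
        exact hβ
      · push Not at hz
        obtain ⟨j, hj, hxj⟩ := hz
        have hj1 : x j = 1 := (hx j).resolve_left hxj
        rw [sum_eq_single_of_mem j hj, hj1, mul_one]
        · exact ((mem1 j).1 hj).2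
        · intro k hk hkj
          rcases hx k with h | h
          · rw [h, mul_zero]
          · exfalso
            have h2 : ∑ i ∈ ({k, j} : Finset (Fin n)), x i ≤ ∑ i ∈ I₁, x i :=
              sum_le_sum_of_subset_of_nonneg
                (by intro i hi; simp at hi; rcases hi with rfl | rfl <;> assumption)
                (fun i _ _ => x0 i)
            rw [sum_pair hkj, h, hj1] at h2
            linarith
    linarith
  · have wa : w a = 1 := by rw [hw, hI₂]; simp [ha]
    have w1 : ∀ i ∈ I, 1 ≤ w i := by
      intro i hi
      rw [hw, hI₂]
      by_cases h : i ∈ I₁ <;> simp [h, hi]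
    unfold pitch
    have h2 : 2 ∈ {k : ℕ | ∀ S ⊆ I, S.card = k → (2 : ℝ) ≤ ∑ i ∈ S, w i} := by
      intro S hS hc
      have := card_nsmul_le_sum S w 1 (fun i hi => w1 i (hS hi))
      rw [hc] at this
      simpa using this
    apply le_antisymm (Nat.sInf_le h2)
    apply le_csInf ⟨2, h2⟩
    intro k hk
    by_contra hlt
    have : k = 0 ∨ k = 1 := by omega
    rcases this with rfl | rfl
    · have := hk ∅ (by simp) (by simp)
      norm_num at this
    · have := hk {a} (by simpa using haI.1) (by simp)
      rw [sum_singleton, wa] at this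
      norm_num at this
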